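/- Let G be a non-abelian finite group. If there exists a bad prime for mci in G, then the quotient G/Z(G) has trivial center. -/

import Mathlib

/-- A prime `p` is a *bad prime for mci* in the finite group `G` if `p` divides `|G|`,
a Sylow `p`-subgroup `P` of `G` has order `p`, and `C_G(P) = P·Z(G)`. -/
def IsBadPrimeForMci (p : ℕ) (G : Type*) [Group G] : Prop :=
  p.Prime ∧ p ∣ Nat.card G ∧
    ∃ P : Sylow p G, Nat.card (P : Subgroup G) = p ∧
      Subgroup.centralizer ((P : Subgroup G) : Set G) =
        (P : Subgroup G) ⊔ Subgroup.center G

open scoped commutatorElement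

/-- If `g` and `x` commute modulo the center, `x ^ n = 1`, and the center has no nontrivial
element of exponent `n`, then `g` and `x` commute. -/
theorem commute_of_commutatorElement_mem_center {G : Type*} [Group G] {n : ℕ}
    (hZ : ∀ z ∈ Subgroup.center G, z ^ n = 1 → z = 1) {g x : G}
    (hc : ⁅g, x⁆ ∈ Subgroup.center G) (hx : x ^ n = 1) : Commute g x := by
  refine commutatorElement_eq_one_iff_commute.mp (hZ _ hc ?_)
  have hcomm : Commute ⁅g, x⁆ x := (Subgroup.mem_center_iff.mp hc x).symm
  have hconj : ⁅g, x⁆ * x = g * x * g⁻¹ := by simp [commutatorElement_def]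
  simpa [hcomm.mul_pow, conj_pow, hx] using congrArg (· ^ n) hconj

/-- If a Sylow `p`-subgroup of order `p` is not central, then the center has no nontrivial
element of exponent `p`. -/
theorem Sylow.eq_one_of_mem_center_of_pow_eq_one {G : Type*} [Group G] [Finite G] {p : ℕ}
    [Fact p.Prime] (P : Sylow p G) (hcard : Nat.card (P : Subgroup G) = p)
    (hP : ¬ (P : Subgroup G) ≤ Subgroup.center G) {z : G}
    (hz : z ∈ Subgroup.center G) (hzp : z ^ p = 1) : z = 1 := by
  by_contra hne
  have hord : orderOf z = p := orderOf_eq_prime hzp hne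
  have hle : Subgroup.zpowers z ≤ Subgroup.center G := by simpa using hz
  have hnormal : (Subgroup.zpowers z).Normal := ⟨fun n hn g => by
    rwa [Subgroup.mem_center_iff.mp (hle hn) g, mul_inv_cancel_right]⟩
  have hpgroup : IsPGroup p (Subgroup.zpowers z) :=
    IsPGroup.of_card (n := 1) (by rw [Nat.card_zpowers, hord, pow_one])
  have hsub : Subgroup.zpowers z ≤ P := hpgroup.le_sylow_of_normal P
  have heq : Subgroup.zpowers z = P :=
    Subgroup.eq_of_le_of_card_ge hsub (by rw [Nat.card_zpowers, hord, hcard])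
  exact hP (heq ▸ hle)

/-- An element whose image in `G ⧸ Z(G)` is central has central commutators. -/
theorem commutatorElement_mem_center_of_mk_mem_center {G : Type*} [Group G] {g : G}
    (hg : (g : G ⧸ Subgroup.center G) ∈ Subgroup.center (G ⧸ Subgroup.center G)) (x : G) :
    ⁅x, g⁆ ∈ Subgroup.center G := by
  rw [← QuotientGroup.eq_one_iff]
  exact commutatorElement_eq_one_iff_commute.mpr (Subgroup.mem_center_iff.mp hg x)

/-- If a non-abelian finite group `G` has a bad prime for mci, then
`G/Z(G)` has trivial center. -/
theorem center_quotient_center_eq_bot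
    {G : Type*} [Group G] [Finite G]
    (hna : ¬ ∀ a b : G, a * b = b * a)
    (h : ∃ p : ℕ, IsBadPrimeForMci p G) :
    Subgroup.center (G ⧸ Subgroup.center G) = ⊥ := by
  obtain ⟨p, hp, -, P, hcard, hcent⟩ := h
  have : Fact p.Prime := ⟨hp⟩
  have hP : ¬ (P : Subgroup G) ≤ Subgroup.center G := fun hle => by
    rw [sup_eq_right.mpr hle, Subgroup.centralizer_eq_top_iff_subset.mpr hle] at hcent
    exact hna fun a b => Subgroup.mem_center_iff.mp (hcent ▸ Subgroup.mem_top b) a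
  have hZ : ∀ z ∈ Subgroup.center G, z ^ p = 1 → z = 1 := fun _ =>
    P.eq_one_of_mem_center_of_pow_eq_one hcard hP
  have hpow : ∀ u ∈ P, u ^ p = 1 := fun u hu =>
    orderOf_dvd_iff_pow_eq_one.mp (hcard ▸ Subgroup.orderOf_dvd_natCard _ hu)
  rw [eq_bot_iff]
  intro q hq
  obtain ⟨g, rfl⟩ := QuotientGroup.mk_surjective q
  have hgP : g ∈ Subgroup.centralizer ((P : Subgroup G) : Set G) := by
    refine Subgroup.mem_centralizer_iff.mpr fun u hu => ?_
    refine (commute_of_commutatorElement_mem_center hZ ?_ (hpow u hu)).symm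
    rw [← commutatorElement_inv]
    exact inv_mem (commutatorElement_mem_center_of_mk_mem_center hq u)
  rw [hcent] at hgP
  obtain ⟨u, hu, z, hz, rfl⟩ := Subgroup.mem_sup_of_normal_right.mp hgP
  rw [QuotientGroup.mk_mul_of_mem u hz] at hq ⊢
  rw [Subgroup.mem_bot, QuotientGroup.eq_one_iff]
  exact Subgroup.mem_center_iff.mpr fun x => commute_of_commutatorElement_mem_center hZ
    (commutatorElement_mem_center_of_mk_mem_center hq x) (hpow u hu)
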